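/- arXiv:2012.00980 — 4 statements merged into one kernel-verified Lean document; each statement's English description precedes it below -/
import Mathlib

section
/- Let (𝓗, 𝒜, P) be a probability space and k : 𝓗×𝓗 → ℝ a measurable symmetric positive-semidefinite kernel with ∫k(x,x)²dP(x) < ∞. Let X₁,…,Xₙ, Y₁,…,Yₘ be i.i.d. with law P and set Δ̂²_{n,m} = (1/n²)∑_{i,s=1}^n k(X_i,X_s) + (1/m²)∑_{j,t=1}^m k(Y_j,Y_t) − (2/nm)∑_{i=1}^n∑_{j=1}^m k(X_i,Y_j). Then for any sequences n_j, m_j → ∞ with n_j/(n_j+m_j) → ρ ∈ (0,1), there exist a constant C ≥ 0 and an index J such that for all j ≥ J, |Var((n_j+m_j)Δ̂²_{n_j,m_j}) − (2(n_j+m_j)⁴/(n_j²m_j²))·∫∫k̃_P(x,y)²dP(x)dP(y)| ≤ C·(1/n_j + 1/m_j), where k̃_P(x,y) = k(x,y) − ∫k(x,z)dP(z) − ∫k(z,y)dP(z) + ∫∫k(z,w)dP(z)dP(w). (The quantity ∫∫k̃_P² dPdP equals the squared Hilbert–Schmidt norm ‖Σ_k(P)‖² of the covariance operator of the kernel features;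 this is the variance expansion of the MMD statistic under the null hypothesis.) -/
open MeasureTheory ProbabilityTheory Filter

/-- The (biased) two-sample MMD statistic `Δ̂²_{n,m}` built from a kernel `k` and the first `n`
`X`-samples and `m` `Y`-samples. -/
noncomputable def DeltaSq {H : Type*} {Ω : Type*} (k : H → H → ℝ)
    (X Y : ℕ → Ω → H) (n m : ℕ) (ω : Ω) : ℝ :=
  ((n : ℝ) ^ 2)⁻¹ * ∑ i : Fin n, ∑ s : Fin n, k (X i ω) (X s ω)
    + ((m : ℝ) ^ 2)⁻¹ * ∑ j : Fin m, ∑ t : Fin m, k (Y j ω) (Y t ω)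
    - 2 * ((n : ℝ) * (m : ℝ))⁻¹ * ∑ i : Fin n, ∑ j : Fin m, k (X i ω) (Y j ω)

/-- The `P`-centered kernel `k̃_P`. -/
noncomputable def tildeK {H : Type*} [MeasurableSpace H] (k : H → H → ℝ) (P : Measure H)
    (x y : H) : ℝ :=
  k x y - ∫ z, k x z ∂P - ∫ z, k z y ∂P + ∫ z, ∫ w, k z w ∂P ∂P

section aux

variable {H : Type*} [MeasurableSpace H] {P : Measure H} [IsProbabilityMeasure P]
  {Ω : Type*} [MeasurableSpace Ω] {μ : Measure Ω} [IsProbabilityMeasure μ]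

lemma aux_degen {S : Type*} [MeasurableSpace S] {h : H → H → ℝ}
    (hm : Measurable (Function.uncurry h)) (h0 : ∀ x, ∫ y, h x y ∂P = 0)
    (T : Ω → S) (hT : Measurable T) (w : Ω → H) (hw : Measurable w)
    (hlaw : Measure.map w μ = P) (hind : IndepFun T w μ)
    (u : S → ℝ) (hu : Measurable u) (p : S → H) (hp : Measurable p) :
    ∫ ω, u (T ω) * h (p (T ω)) (w ω) ∂μ = 0 := by
  have hF : Measurable (fun q : S × H => u q.1 * h (p q.1) q.2) := by
    refine (hu.comp measurable_fst).mul ?_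
    exact hm.comp ((hp.comp measurable_fst).prodMk measurable_snd)
  have h1 : ∫ ω, u (T ω) * h (p (T ω)) (w ω) ∂μ
      = ∫ q, u q.1 * h (p q.1) q.2 ∂(Measure.map (fun ω => (T ω, w ω)) μ) := by
    rw [integral_map (hT.prodMk hw).aemeasurable hF.aestronglyMeasurable]
  by_cases hi : Integrable (fun q : S × H => u q.1 * h (p q.1) q.2)
      (Measure.map (fun ω => (T ω, w ω)) μ)
  · rw [h1]
    have := (indepFun_iff_map_prod_eq_prod_map_map hT.aemeasurable hw.aemeasurable).1 hind
    rw [this, hlaw] at hi ⊢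
    have : IsProbabilityMeasure (Measure.map T μ) := Measure.isProbabilityMeasure_map hT.aemeasurable
    rw [integral_prod _ hi]
    simp [integral_const_mul, h0]
  · rw [h1, integral_undef hi]

lemma aux_cov {ι : Type*} [DecidableEq ι] (W : ι → Ω → H) (hW : ∀ i, Measurable (W i))
    (hind : iIndepFun W μ) (hlaw : ∀ i, Measure.map (W i) μ = P)
    {h : H → H → ℝ} (hm : Measurable (Function.uncurry h)) (hs : ∀ x y, h x y = h y x)
    (h0 : ∀ x, ∫ y, h x y ∂P = 0)
    (hL : ∀ a b, MemLp (fun ω => h (W a ω) (W b ω)) 2 μ) (a b c d : ι) :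
    covariance (fun ω => h (W a ω) (W b ω)) (fun ω => h (W c ω) (W d ω)) μ
      = (if a = b then if a = c then if a = d then
          (variance (fun x => h x x) P - 2 * ∫ x, ∫ y, (h x y) ^ 2 ∂P ∂P) else 0 else 0 else 0)
        + (if a = c then if b = d then ∫ x, ∫ y, (h x y) ^ 2 ∂P ∂P else 0 else 0)
        + (if a = d then if b = c then ∫ x, ∫ y, (h x y) ^ 2 ∂P ∂P else 0 else 0) := by
  have mean0 : ∀ c d, c ≠ d → ∫ ω, h (W c ω) (W d ω) ∂μ = 0 := by
    intro c d hcd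
    have := aux_degen hm h0 (W c) (hW c) (W d) (hW d) (hlaw d) (hind.indepFun hcd)
      (fun _ => 1) measurable_const id measurable_id
    simpa using this
  have key : ∀ a b c d, d ≠ a → d ≠ b → d ≠ c →
      covariance (fun ω => h (W a ω) (W b ω)) (fun ω => h (W c ω) (W d ω)) μ = 0 := by
    intro a b c d hda hdb hdc
    rw [covariance_eq_sub (hL a b) (hL c d), mean0 c d hdc.symm]
    have hI := hind.indepFun_finset {a, b, c} {d} (by simp [hda, hdb, hdc]) hW
    have hI2 : IndepFun (fun ω => (W a ω, W b ω, W c ω)) (W d) μ :=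
      hI.comp (φ := fun f : (({a, b, c} : Finset ι) → H) =>
          (f ⟨a, by simp⟩, f ⟨b, by simp⟩, f ⟨c, by simp⟩))
        (ψ := fun f : (({d} : Finset ι) → H) => f ⟨d, by simp⟩)
        ((measurable_pi_apply _).prodMk ((measurable_pi_apply _).prodMk (measurable_pi_apply _)))
        (measurable_pi_apply _)
    have := aux_degen hm h0 (fun ω => (W a ω, W b ω, W c ω))
      ((hW a).prodMk ((hW b).prodMk (hW c))) (W d) (hW d) (hlaw d) hI2
      (fun s => h s.1 s.2.1) (hm.comp (measurable_fst.prodMk measurable_snd.fst))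
      (fun s => s.2.2) measurable_snd.snd
    simpa using this
  have sw : ∀ c d, (fun ω => h (W c ω) (W d ω)) = (fun ω => h (W d ω) (W c ω)) := by
    intro c d; ext ω; exact hs _ _
  have sq : ∀ a b, a ≠ b → covariance (fun ω => h (W a ω) (W b ω))
      (fun ω => h (W a ω) (W b ω)) μ = ∫ x, ∫ y, (h x y) ^ 2 ∂P ∂P := by
    intro a b hab
    rw [covariance_eq_sub (hL a b) (hL a b), mean0 a b hab]
    have hmap := (indepFun_iff_map_prod_eq_prod_map_map (hW a).aemeasurable
      (hW b).aemeasurable).1 (hind.indepFun hab)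
    rw [hlaw, hlaw] at hmap
    have hm2 : Measurable (fun q : H × H => (h q.1 q.2) ^ 2) := by
      have : Measurable (fun q : H × H => h q.1 q.2) := hm
      exact this.pow_const 2
    have hi : Integrable (fun q : H × H => (h q.1 q.2) ^ 2) (P.prod P) := by
      rw [← hmap, integrable_map_measure hm2.aestronglyMeasurable
        ((hW a).prodMk (hW b)).aemeasurable]
      exact (hL a b).integrable_sq
    rw [← integral_prod _ hi, ← hmap, integral_map ((hW a).prodMk (hW b)).aemeasurable
      hm2.aestronglyMeasurable]
    simp [pow_two]
  by_cases hab : a = b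
  · subst hab
    by_cases hcd : c = d
    · subst hcd
      by_cases hac : a = c
      · subst hac
        simp only [if_true]
        rw [covariance_self (hL a a).aemeasurable]
        have hd : Measurable (fun x => h x x) := hm.comp (measurable_id.prodMk measurable_id)
        have : variance (fun ω => h (W a ω) (W a ω)) μ = variance (fun x => h x x) P := by
          rw [← hlaw a, variance_map hd.aemeasurable (hW a).aemeasurable]; rfl
        rw [this]; ring
      · simp only [hac, if_false, if_true]
        have hd : Measurable (fun x => h x x) := hm.comp (measurable_id.prodMk measurable_id)
        have := ((hind.indepFun hac).comp hd hd).covariance_eq_zero (hL a a) (hL c c)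
        simpa [Function.comp_def] using this
    · by_cases had : a = d
      · subst had
        rw [sw c a, key a a a c hcd hcd hcd]
        simp [Ne.symm hcd]
      · rw [key a a c d (Ne.symm had) (Ne.symm had) (Ne.symm hcd)]
        simp [had]
  · by_cases h1 : a = c ∧ b = d
    · obtain ⟨rfl, rfl⟩ := h1
      rw [sq a b hab]; simp [hab]
    by_cases h2 : a = d ∧ b = c
    · obtain ⟨rfl, rfl⟩ := h2
      rw [sw b a, sq a b hab]; simp [hab]
    have hz : covariance (fun ω => h (W a ω) (W b ω)) (fun ω => h (W c ω) (W d ω)) μ = 0 := by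
      by_cases hA : a ≠ c ∧ a ≠ d
      · rw [covariance_comm, sw a b]
        exact key c d b a hA.1 hA.2 hab
      · have hB : b ≠ c ∧ b ≠ d := by
          by_contra hB
          grind
        rw [covariance_comm]
        exact key c d a b hB.1 hB.2 (Ne.symm hab)
    rw [hz]
    grind

lemma aux_var {ι : Type*} [Fintype ι] [DecidableEq ι] (W : ι → Ω → H)
    (hW : ∀ i, Measurable (W i))
    (hind : iIndepFun W μ) (hlaw : ∀ i, Measure.map (W i) μ = P)
    {h : H → H → ℝ} (hm : Measurable (Function.uncurry h)) (hs : ∀ x y, h x y = h y x)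
    (h0 : ∀ x, ∫ y, h x y ∂P = 0)
    (G : H → ℝ) (hG : MemLp G 2 P) (hGb : ∀ x y, |h x y| ≤ G x + G y) (w : ι → ℝ) :
    variance (fun ω => ∑ a, ∑ b, w a * w b * h (W a ω) (W b ω)) μ
      = (∑ a, w a ^ 4) *
          (variance (fun x => h x x) P - 2 * ∫ x, ∫ y, (h x y) ^ 2 ∂P ∂P)
        + 2 * (∑ a, w a ^ 2) ^ 2 * ∫ x, ∫ y, (h x y) ^ 2 ∂P ∂P := by
  have hGW : ∀ a, MemLp (fun ω => G (W a ω)) 2 μ := by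
    intro a
    have := hG
    rw [← hlaw a] at this
    exact this.comp_of_map (hW a).aemeasurable
  have hL : ∀ a b, MemLp (fun ω => h (W a ω) (W b ω)) 2 μ := by
    intro a b
    refine ((hGW a).add (hGW b)).mono'
      (hm.comp ((hW a).prodMk (hW b))).aestronglyMeasurable (ae_of_all _ fun ω => ?_)
    exact hGb _ _
  have e1 : (fun ω => ∑ a, ∑ b, w a * w b * h (W a ω) (W b ω))
      = fun ω => ∑ p : ι × ι, w p.1 * w p.2 * h (W p.1 ω) (W p.2 ω) := by
    ext ω; rw [Fintype.sum_prod_type]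
  rw [e1, variance_fun_sum (X := fun (p : ι × ι) ω => w p.1 * w p.2 * h (W p.1 ω) (W p.2 ω))
    (fun p => (hL p.1 p.2).const_mul _)]
  simp_rw [covariance_const_mul_left, covariance_const_mul_right,
    aux_cov W hW hind hlaw hm hs h0 hL, Fintype.sum_prod_type]
  generalize variance (fun x => h x x) P - 2 * ∫ x, ∫ y, (h x y) ^ 2 ∂P ∂P = A
  generalize ∫ x, ∫ y, (h x y) ^ 2 ∂P ∂P = B
  simp only [mul_add, Finset.sum_add_distrib, mul_ite, mul_zero]
  simp [Finset.sum_ite_eq]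
  have s1 : ∀ a b : ι, w a * w b * (w a * w b * B) = w a ^ 2 * w b ^ 2 * B := by intros; ring
  have s2 : ∀ a b : ι, w a * w b * (w b * w a * B) = w a ^ 2 * w b ^ 2 * B := by intros; ring
  have s3 : ∀ a : ι, w a * w a * (w a * w a * A) = w a ^ 4 * A := by intros; ring
  simp only [s1, s2, s3, ← Finset.sum_mul, ← Finset.mul_sum]
  ring

end aux

lemma aux_kernel {H : Type*} [MeasurableSpace H] (P : Measure H) [IsProbabilityMeasure P]
    (k : H → H → ℝ) (hk_meas : Measurable (Function.uncurry k))
    (hk_symm : ∀ x y, k x y = k y x)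
    (hk_psd : ∀ (N : ℕ) (c : Fin N → ℝ) (x : Fin N → H),
      0 ≤ ∑ i, ∑ j, c i * c j * k (x i) (x j))
    (hk_int : Integrable (fun x => (k x x) ^ 2) P) :
    Measurable (Function.uncurry (tildeK k P)) ∧ (∀ x y, tildeK k P x y = tildeK k P y x) ∧
    (∀ x, ∫ y, tildeK k P x y ∂P = 0) ∧
    ∃ G : H → ℝ, MemLp G 2 P ∧ ∀ x y, |tildeK k P x y| ≤ G x + G y := by
  have hb : ∀ x y, |k x y| ≤ (k x x + k y y) / 2 := by
    intro x y
    have h1 := hk_psd 2 ![1, 1] ![x, y]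
    have h2 := hk_psd 2 ![1, -1] ![x, y]
    simp [Fin.sum_univ_two] at h1 h2
    have := hk_symm x y
    rw [abs_le]; constructor <;> linarith
  have hd : Measurable (fun x => k x x) := hk_meas.comp (measurable_id.prodMk measurable_id)
  have hdL : MemLp (fun x => k x x) 2 P :=
    (memLp_two_iff_integrable_sq hd.aestronglyMeasurable).2 hk_int
  have hdi : Integrable (fun x => k x x) P := hdL.integrable (by norm_num)
  have hki : ∀ x, Integrable (fun y => k x y) P := by
    intro x
    refine Integrable.mono' (((integrable_const (k x x)).add hdi).div_const 2)
      (hk_meas.comp (measurable_const.prodMk measurable_id)).aestronglyMeasurable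
      (ae_of_all _ fun y => ?_)
    exact hb x y
  set K := ∫ z, k z z ∂P with hK
  set f : H → ℝ := fun x => ∫ z, k x z ∂P with hf
  have hfm : Measurable f := by
    have := (hk_meas.stronglyMeasurable).integral_prod_right (ν := P)
    exact this.measurable
  have hfb : ∀ x, |f x| ≤ (k x x + K) / 2 := by
    intro x
    calc |f x| ≤ ∫ z, |k x z| ∂P := abs_integral_le_integral_abs
      _ ≤ ∫ z, (k x x + k z z) / 2 ∂P :=
        integral_mono (hki x).abs (((integrable_const (k x x)).add hdi).div_const 2) (hb x)
      _ = (k x x + K) / 2 := by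
        rw [integral_div, integral_add (integrable_const _) hdi]; simp [hK]
  have hfi : Integrable f P :=
    Integrable.mono' ((hdi.add (integrable_const K)).div_const 2)
      hfm.aestronglyMeasurable (ae_of_all _ hfb)
  have hM : |∫ z, f z ∂P| ≤ K := by
    calc |∫ z, f z ∂P| ≤ ∫ z, |f z| ∂P := abs_integral_le_integral_abs
      _ ≤ ∫ z, (k z z + K) / 2 ∂P :=
        integral_mono hfi.abs ((hdi.add (integrable_const K)).div_const 2) hfb
      _ = K := by
        rw [integral_div, integral_add hdi (integrable_const _)]; simp [← hK]
  have ht : ∀ x y, tildeK k P x y = k x y - f x - f y + ∫ z, f z ∂P := by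
    intro x y
    have : ∫ z, k z y ∂P = f y := by
      simp only [hf]; congr 1; ext z; exact hk_symm _ _
    unfold tildeK
    rw [this]
  refine ⟨?_, ?_, ?_, fun x => k x x + K, hdL.add (memLp_const K), ?_⟩
  · have : Function.uncurry (tildeK k P)
        = fun q : H × H => k q.1 q.2 - f q.1 - f q.2 + ∫ z, f z ∂P := by
      ext q; exact ht _ _
    rw [this]
    have hk' : Measurable (fun q : H × H => k q.1 q.2) := hk_meas
    fun_prop
  · intro x y; rw [ht, ht, hk_symm x y]; ring
  · intro x
    simp_rw [ht]
    have i1 : Integrable (fun y => k x y - f x) P := (hki x).sub (integrable_const _)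
    have i2 : Integrable (fun y => k x y - f x - f y) P := i1.sub hfi
    rw [integral_add i2 (integrable_const _), integral_sub i1 hfi,
      integral_sub (hki x) (integrable_const _)]
    simp [hf]
  · intro x y
    rw [ht]
    have h1 := abs_le.1 (hb x y)
    have h2 := abs_le.1 (hfb x)
    have h3 := abs_le.1 (hfb y)
    have h4 := abs_le.1 hM
    rw [abs_le]; constructor <;> linarith [h1.1, h1.2, h2.1, h2.2, h3.1, h3.2, h4.1, h4.2]

lemma aux_exact {H : Type*} [MeasurableSpace H] (P : Measure H) [IsProbabilityMeasure P]
    (k : H → H → ℝ) (hk_meas : Measurable (Function.uncurry k))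
    (hk_symm : ∀ x y, k x y = k y x)
    (hk_psd : ∀ (N : ℕ) (c : Fin N → ℝ) (x : Fin N → H),
      0 ≤ ∑ i, ∑ j, c i * c j * k (x i) (x j))
    (hk_int : Integrable (fun x => (k x x) ^ 2) P)
    {Ω : Type*} [MeasurableSpace Ω] (μ : Measure Ω) [IsProbabilityMeasure μ]
    (Z : ℕ ⊕ ℕ → Ω → H) (hZ_meas : ∀ i, Measurable (Z i))
    (hZ_indep : iIndepFun Z μ)
    (hZ_law : ∀ i, Measure.map (Z i) μ = P) (n m : ℕ) (hn : 0 < n) (hm : 0 < m) :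
    variance (fun ω => DeltaSq k (fun i => Z (Sum.inl i)) (fun i => Z (Sum.inr i)) n m ω) μ
      = (1 / (n : ℝ) ^ 3 + 1 / (m : ℝ) ^ 3) *
          (variance (fun x => tildeK k P x x) P - 2 * ∫ x, ∫ y, (tildeK k P x y) ^ 2 ∂P ∂P)
        + 2 * (1 / (n : ℝ) + 1 / (m : ℝ)) ^ 2 * ∫ x, ∫ y, (tildeK k P x y) ^ 2 ∂P ∂P := by
  obtain ⟨h1, h2, h3, G, hG, hGb⟩ := aux_kernel P k hk_meas hk_symm hk_psd hk_int
  have hn0 : (n : ℝ) ≠ 0 := by positivity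
  have hm0 : (m : ℝ) ≠ 0 := by positivity
  let g : Fin n ⊕ Fin m → ℕ ⊕ ℕ := Sum.map Fin.val Fin.val
  have hg : Function.Injective g := Sum.map_injective.2 ⟨Fin.val_injective, Fin.val_injective⟩
  let w : Fin n ⊕ Fin m → ℝ := Sum.elim (fun _ => 1 / (n : ℝ)) (fun _ => -(1 / (m : ℝ)))
  have hv := aux_var (fun i => Z (g i)) (fun i => hZ_meas _) (hZ_indep.precomp hg)
    (fun i => hZ_law _) h1 h2 h3 G hG hGb w
  have w4 : ∑ a, w a ^ 4 = 1 / (n : ℝ) ^ 3 + 1 / (m : ℝ) ^ 3 := by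
    simp [w]; field_simp
  have w2 : ∑ a, w a ^ 2 = 1 / (n : ℝ) + 1 / (m : ℝ) := by
    simp [w]; field_simp
  have w1 : ∑ a, w a = 0 := by
    simp [w, hn0, hm0]
  rw [w4, w2] at hv
  rw [← hv]
  congr 1
  ext ω
  have e1 : ∀ x y, tildeK k P x y = k x y - ∫ z, k x z ∂P - ∫ z, k z y ∂P
      + ∫ z, ∫ w, k z w ∂P ∂P := fun _ _ => rfl
  generalize ∫ z, ∫ w, k z w ∂P ∂P = M at e1
  have e2 : ∑ a, ∑ b, w a * w b * tildeK k P (Z (g a) ω) (Z (g b) ω)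
      = ∑ a, ∑ b, w a * w b * k (Z (g a) ω) (Z (g b) ω) := by
    have : ∀ a b, w a * w b * tildeK k P (Z (g a) ω) (Z (g b) ω)
        = w a * w b * k (Z (g a) ω) (Z (g b) ω) - (w a * ∫ z, k (Z (g a) ω) z ∂P) * w b
          - w a * (w b * ∫ z, k z (Z (g b) ω) ∂P) + w a * M * w b := by
      intro a b; rw [e1]; ring
    simp_rw [this, Finset.sum_add_distrib, Finset.sum_sub_distrib, ← Finset.mul_sum,
      ← Finset.sum_mul, w1]
    simp
  rw [e2]
  simp only [DeltaSq, Fintype.sum_sum_type, w, g, Sum.elim_inl, Sum.elim_inr, Sum.map_inl,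
    Sum.map_inr, Finset.sum_add_distrib, ← Finset.mul_sum]
  rw [Finset.sum_comm (s := (Finset.univ : Finset (Fin m)))
    (t := (Finset.univ : Finset (Fin n)))]
  simp_rw [fun (i : Fin m) (j : Fin n) => hk_symm (Z (Sum.inr i) ω) (Z (Sum.inl j) ω)]
  field_simp
  ring

theorem stmt9 {H : Type*} [MeasurableSpace H] (P : Measure H) [IsProbabilityMeasure P]
    (k : H → H → ℝ) (hk_meas : Measurable (Function.uncurry k))
    (hk_symm : ∀ x y, k x y = k y x)
    (hk_psd : ∀ (N : ℕ) (c : Fin N → ℝ) (x : Fin N → H),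
      0 ≤ ∑ i, ∑ j, c i * c j * k (x i) (x j))
    (hk_int : Integrable (fun x => (k x x) ^ 2) P)
    {Ω : Type*} [MeasurableSpace Ω] (μ : Measure Ω) [IsProbabilityMeasure μ]
    (Z : ℕ ⊕ ℕ → Ω → H) (hZ_meas : ∀ i, Measurable (Z i))
    (hZ_indep : iIndepFun Z μ)
    (hZ_law : ∀ i, Measure.map (Z i) μ = P)
    (n m : ℕ → ℕ) (hn : Tendsto n atTop atTop) (hm : Tendsto m atTop atTop)
    (ρ : ℝ) (hρ0 : 0 < ρ) (hρ1 : ρ < 1)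
    (hratio : Tendsto (fun j => (n j : ℝ) / ((n j : ℝ) + (m j : ℝ))) atTop (nhds ρ)) :
    ∃ C : ℝ, 0 ≤ C ∧ ∃ J : ℕ, ∀ j ≥ J,
      |variance (fun ω => ((n j : ℝ) + (m j : ℝ)) *
            DeltaSq k (fun i => Z (Sum.inl i)) (fun i => Z (Sum.inr i)) (n j) (m j) ω) μ
          - 2 * ((n j : ℝ) + (m j : ℝ)) ^ 4 / ((n j : ℝ) ^ 2 * (m j : ℝ) ^ 2)
            * ∫ x, ∫ y, (tildeK k P x y) ^ 2 ∂P ∂P|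
        ≤ C * (1 / (n j : ℝ) + 1 / (m j : ℝ)) := by
  set E := ∫ x, ∫ y, (tildeK k P x y) ^ 2 ∂P ∂P with hE
  set V := variance (fun x => tildeK k P x x) P with hV
  have hr1 : ∀ᶠ j in atTop, ρ / 2 < (n j : ℝ) / ((n j : ℝ) + (m j : ℝ)) :=
    hratio.eventually (lt_mem_nhds (by linarith))
  have hr2 : ∀ᶠ j in atTop, (n j : ℝ) / ((n j : ℝ) + (m j : ℝ)) < (1 + ρ) / 2 :=
    hratio.eventually (gt_mem_nhds (by linarith))
  have hn1 := hn.eventually_gt_atTop 0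
  have hm1 := hm.eventually_gt_atTop 0
  obtain ⟨J, hJ⟩ := eventually_atTop.1 (hr1.and (hr2.and (hn1.and hm1)))
  have hA0 : 0 ≤ (2 / ρ) ^ 2 := by positivity
  have hB0 : 0 ≤ (2 / (1 - ρ)) ^ 2 := by positivity
  refine ⟨((2 / ρ) ^ 2 + (2 / (1 - ρ)) ^ 2) * |V - 2 * E|, by positivity, J, fun j hj => ?_⟩
  obtain ⟨a1, a2, a3, a4⟩ := hJ j hj
  have hex := aux_exact P k hk_meas hk_symm hk_psd hk_int μ Z hZ_meas hZ_indep hZ_law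
    (n j) (m j) a3 a4
  rw [variance_const_mul, hex, ← hE, ← hV]
  have x0 : (0 : ℝ) < n j := by exact_mod_cast a3
  have y0 : (0 : ℝ) < m j := by exact_mod_cast a4
  generalize (n j : ℝ) = x at *
  generalize (m j : ℝ) = y at *
  have hs : 0 < x + y := by positivity
  rw [lt_div_iff₀ hs] at a1
  rw [div_lt_iff₀ hs] at a2
  have b1 : (x + y) / x ≤ 2 / ρ := by
    rw [div_le_div_iff₀ x0 hρ0]; linarith
  have b2 : (x + y) / y ≤ 2 / (1 - ρ) := by
    rw [div_le_div_iff₀ y0 (by linarith)]; linarith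
  have c1 : ((x + y) / x) ^ 2 ≤ (2 / ρ) ^ 2 := pow_le_pow_left₀ (by positivity) b1 2
  have c2 : ((x + y) / y) ^ 2 ≤ (2 / (1 - ρ)) ^ 2 := pow_le_pow_left₀ (by positivity) b2 2
  have e : (x + y) ^ 2 * ((1 / x ^ 3 + 1 / y ^ 3) * (V - 2 * E) + 2 * (1 / x + 1 / y) ^ 2 * E)
      - 2 * (x + y) ^ 4 / (x ^ 2 * y ^ 2) * E
      = (((x + y) / x) ^ 2 * (1 / x) + ((x + y) / y) ^ 2 * (1 / y)) * (V - 2 * E) := by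
    field_simp
    ring
  rw [e, abs_mul, abs_of_nonneg (by positivity)]
  have d1 : ((x + y) / x) ^ 2 * (1 / x) ≤ (2 / ρ) ^ 2 * (1 / x) :=
    mul_le_mul_of_nonneg_right c1 (by positivity)
  have d2 : ((x + y) / y) ^ 2 * (1 / y) ≤ (2 / (1 - ρ)) ^ 2 * (1 / y) :=
    mul_le_mul_of_nonneg_right c2 (by positivity)
  have d3 : 0 ≤ (2 / ρ) ^ 2 * (1 / y) := by positivity
  have d4 : 0 ≤ (2 / (1 - ρ)) ^ 2 * (1 / x) := by positivity
  calc _ ≤ (((2 / ρ) ^ 2 + (2 / (1 - ρ)) ^ 2) * (1 / x + 1 / y)) * |V - 2 * E| := by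
        refine mul_le_mul_of_nonneg_right ?_ (abs_nonneg _)
        linarith
    _ = _ := by ring
end

section
/- Let d ≥ 1, σ > 0, μ, m₀ ∈ ℝ^d, and let Σ, Σ₀ be d×d symmetric positive-definite matrices; set δ = m₀ − μ. For the Gaussian kernel k_σ on ℝ^d, J_{k_σ}(N(μ,Σ), N(m₀,Σ₀)) = det(I_d+4σΣ+4σΣ₀)^{-1/2}·exp(−2σ·δᵀ(I_d+4σΣ+4σΣ₀)⁻¹δ) − det(I_d+2σΣ₀)^{-1/2}·det(I_d+2σΣ₀+4σΣ)^{-1/2}·exp(−2σ·δᵀ(I_d+2σΣ₀+4σΣ)⁻¹δ) − det(I_d+2σΣ)^{-1/2}·det(I_d+2σΣ+4σΣ₀)^{-1/2}·exp(−2σ·δᵀ(I_d+2σΣ+4σΣ₀)⁻¹δ) + det(I_d+2σΣ+2σΣ₀)^{-1}·exp(−2σ·δᵀ(I_d+2σΣ+2σΣ₀)⁻¹δ). -/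
open MeasureTheory Matrix

/-- The Gaussian measure `N(m, S)` on `ℝ^d`, defined by its density with respect to
Lebesgue measure. -/
noncomputable def gaussianMeasure {d : ℕ} (m : Fin d → ℝ) (S : Matrix (Fin d) (Fin d) ℝ) :
    Measure (Fin d → ℝ) :=
  volume.withDensity fun x =>
    ENNReal.ofReal (((2 * Real.pi) ^ d * S.det) ^ (-(1 : ℝ) / 2) *
      Real.exp (-(1 / 2) * ((x - m) ⬝ᵥ (S⁻¹ *ᵥ (x - m)))))

/-- The Gaussian kernel `k_σ(x,y) = exp(-σ‖x-y‖²)` on `ℝ^d`. -/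
noncomputable def gaussKernel {d : ℕ} (σ : ℝ) (x y : Fin d → ℝ) : ℝ :=
  Real.exp (-σ * ∑ i, (x i - y i) ^ 2)

/-- `J_k(P,Q)`, the Hilbert–Schmidt inner product of the covariance operators of the kernel
features, expressed through integrals of the kernel. -/
noncomputable def Jk {α : Type*} [MeasurableSpace α] (k : α → α → ℝ) (P Q : Measure α) : ℝ :=
  (∫ x, ∫ y, (k x y) ^ 2 ∂Q ∂P) - (∫ x, (∫ y, k x y ∂Q) ^ 2 ∂P)
    - (∫ y, (∫ x, k x y ∂P) ^ 2 ∂Q) + (∫ x, ∫ y, k x y ∂Q ∂P) ^ 2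

open scoped MatrixOrder in
theorem gauss_core {d : ℕ} (M : Matrix (Fin d) (Fin d) ℝ) (hM : M.PosDef) :
    ∫ x : Fin d → ℝ, Real.exp (-(1/2) * (x ⬝ᵥ (M *ᵥ x))) = Real.sqrt ((2*Real.pi)^d / M.det) := by
  set L := CFC.sqrt M with hL
  have hLL : L * L = M := CFC.sqrt_mul_sqrt_self M hM.posSemidef.nonneg
  have hLs : Lᵀ = L := by
    have := (CFC.sqrt_nonneg M).isSelfAdjoint
    rw [isSelfAdjoint_iff, star_eq_conjTranspose, conjTranspose_eq_transpose_of_trivial] at this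
    exact this
  have hdet : L.det * L.det = M.det := by rw [← det_mul, hLL]
  have hMd := hM.det_pos
  have hd0 : L.det ≠ 0 := by
    intro h; rw [h] at hdet; simp at hdet; linarith
  have key : ∀ x : Fin d → ℝ, x ⬝ᵥ (M *ᵥ x) = ∑ i, (toLin' L x i)^2 := by
    intro x
    have : x ⬝ᵥ (M *ᵥ x) = (L *ᵥ x) ⬝ᵥ (L *ᵥ x) := by
      rw [← hLL, ← mulVec_mulVec, dotProduct_mulVec, ← mulVec_transpose, hLs]
    rw [this]; simp [dotProduct, sq]
  have h1 := Real.map_matrix_volume_pi_eq_smul_volume_pi hd0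
  have h2 : ∫ y : Fin d → ℝ, Real.exp (-(1/2) * ∑ i, (y i)^2) = Real.sqrt ((2*Real.pi)^d) := by
    simp_rw [Finset.mul_sum, Real.exp_sum]
    rw [integral_fintype_prod_volume_eq_prod (f := fun _ (v:ℝ) => Real.exp (-(1/2) * v^2))]
    simp_rw [integral_gaussian]
    rw [Finset.prod_const, Finset.card_univ, Fintype.card_fin]
    rw [show Real.pi / (1/2) = 2 * Real.pi by ring]
    symm
    rw [Real.sqrt_eq_iff_mul_self_eq (by positivity) (by positivity), ← mul_pow, Real.mul_self_sqrt (by positivity)]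
  have h3 : ∫ x : Fin d → ℝ, Real.exp (-(1/2) * ∑ i, (toLin' L x i)^2) = |L.det⁻¹| * Real.sqrt ((2*Real.pi)^d) := by
    rw [← h2, ← integral_map (μ := volume) (φ := toLin' L) (f := fun y : Fin d → ℝ => Real.exp (-(1/2) * ∑ i, (y i)^2)), h1, integral_smul_measure]
    · simp
    · exact (LinearMap.continuous_of_finiteDimensional _).aemeasurable
    · exact (by fun_prop : Continuous fun y : Fin d → ℝ => Real.exp (-(1/2) * ∑ i, (y i)^2)).aestronglyMeasurable
  simp_rw [key]
  rw [h3, Real.sqrt_div (by positivity), ← hdet, Real.sqrt_mul_self_eq_abs, abs_inv]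
  field_simp

theorem dsym {d : ℕ} {N : Matrix (Fin d) (Fin d) ℝ} (h : Nᵀ = N) (x y : Fin d → ℝ) :
    x ⬝ᵥ (N *ᵥ y) = y ⬝ᵥ (N *ᵥ x) := by
  rw [dotProduct_mulVec, ← mulVec_transpose, h, dotProduct_comm]

theorem complete_sq {d : ℕ} (B S : Matrix (Fin d) (Fin d) ℝ) (hB : B.PosDef) (hS : S.PosDef)
    (y b : Fin d → ℝ) :
    (y - b) ⬝ᵥ (B⁻¹ *ᵥ (y - b)) + y ⬝ᵥ (S⁻¹ *ᵥ y) =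
      (y - S *ᵥ ((B+S)⁻¹ *ᵥ b)) ⬝ᵥ ((B⁻¹ + S⁻¹) *ᵥ (y - S *ᵥ ((B+S)⁻¹ *ᵥ b)))
        + b ⬝ᵥ ((B+S)⁻¹ *ᵥ b) := by
  have tr : ∀ N : Matrix (Fin d) (Fin d) ℝ, N.PosDef → Nᵀ = N := fun N h => by
    have := h.isHermitian
    rwa [IsHermitian, conjTranspose_eq_transpose_of_trivial] at this
  have hBS := hB.add hS
  have uB := hB.det_pos.ne'.isUnit
  have uS := hS.det_pos.ne'.isUnit
  have uBS := hBS.det_pos.ne'.isUnit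
  obtain ⟨u, rfl⟩ : ∃ u, (B+S) *ᵥ u = b := ⟨(B+S)⁻¹ *ᵥ b, by
    rw [mulVec_mulVec, mul_nonsing_inv _ uBS, one_mulVec]⟩
  have e1 : (B+S)⁻¹ *ᵥ ((B+S) *ᵥ u) = u := by
    rw [mulVec_mulVec, nonsing_inv_mul _ uBS, one_mulVec]
  have e2 : B⁻¹ *ᵥ (B *ᵥ u) = u := by
    rw [mulVec_mulVec, nonsing_inv_mul _ uB, one_mulVec]
  have e3 : S⁻¹ *ᵥ (S *ᵥ u) = u := by
    rw [mulVec_mulVec, nonsing_inv_mul _ uS, one_mulVec]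
  rw [e1]
  have f1 := dsym (tr _ hB.inv) y (S *ᵥ u)
  have f2 := dsym (tr _ hB.inv) y (B *ᵥ u)
  have f3 := dsym (tr _ hS.inv) y (S *ᵥ u)
  have f4 := dsym (tr _ hB.inv) (B *ᵥ u) (S *ᵥ u)
  simp only [add_mulVec, mulVec_sub, mulVec_add, sub_dotProduct, dotProduct_sub, dotProduct_add, add_dotProduct, e2, e3] at *
  rw [dotProduct_comm (S *ᵥ u) u, dotProduct_comm (B *ᵥ u) u] at *
  linarith

theorem gauss_int {d : ℕ} (B S : Matrix (Fin d) (Fin d) ℝ) (hB : B.PosDef) (hS : S.PosDef)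
    (a m : Fin d → ℝ) :
    ∫ x : Fin d → ℝ, Real.exp (-(1/2) * ((x - a) ⬝ᵥ (B⁻¹ *ᵥ (x - a)))) *
      Real.exp (-(1/2) * ((x - m) ⬝ᵥ (S⁻¹ *ᵥ (x - m)))) =
    Real.sqrt ((2*Real.pi)^d * S.det * (B.det / (B + S).det)) *
      Real.exp (-(1/2) * ((a - m) ⬝ᵥ ((B+S)⁻¹ *ᵥ (a - m)))) := by
  have uB := hB.det_pos.ne'.isUnit
  have uS := hS.det_pos.ne'.isUnit
  have hdet : (B⁻¹ + S⁻¹).det = (B+S).det / (B.det * S.det) := by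
    have : B * (B⁻¹ + S⁻¹) * S = B + S := by
      rw [mul_add, mul_nonsing_inv _ uB, add_mul, one_mul, mul_assoc, nonsing_inv_mul _ uS, mul_one, add_comm]
    rw [← this, det_mul, det_mul]
    field_simp [hB.det_pos.ne', hS.det_pos.ne']
  have h := fun x : Fin d → ℝ => complete_sq B S hB hS (x - m) (a - m)
  simp_rw [sub_sub_sub_cancel_right] at h
  simp_rw [← Real.exp_add, ← mul_add, h, mul_add, Real.exp_add]
  rw [integral_mul_const]
  simp_rw [sub_sub]
  rw [integral_sub_right_eq_self (fun x : Fin d → ℝ => Real.exp (-(1/2) * (x ⬝ᵥ ((B⁻¹ + S⁻¹) *ᵥ x)))), gauss_core _ (hB.inv.add hS.inv), hdet]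
  congr 2
  have := (hB.add hS).det_pos.ne'
  field_simp

theorem inv_smul_mat {d : ℕ} (c : ℝ) (hc : c ≠ 0) (A : Matrix (Fin d) (Fin d) ℝ) (hA : A.PosDef) :
    (c • A)⁻¹ = c⁻¹ • A⁻¹ := by
  apply inv_eq_right_inv
  rw [smul_mul_smul_comm, mul_nonsing_inv _ hA.det_pos.ne'.isUnit, mul_inv_cancel₀ hc, one_smul]

theorem gm_int {d : ℕ} (t : ℝ) (ht : 0 < t) (A S : Matrix (Fin d) (Fin d) ℝ)
    (hA : A.PosDef) (hS : S.PosDef) (a m : Fin d → ℝ) :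
    ∫ x, Real.exp (-t * ((x - a) ⬝ᵥ (A⁻¹ *ᵥ (x - a)))) ∂(gaussianMeasure m S) =
      Real.sqrt A.det * (A + (2 * t) • S).det ^ (-(1 : ℝ) / 2) *
        Real.exp (-t * ((a - m) ⬝ᵥ ((A + (2 * t) • S)⁻¹ *ᵥ (a - m)))) := by
  have h2t : 0 < 2 * t := by positivity
  have hAS : (A + (2 * t) • S).PosDef := hA.add (hS.smul h2t)
  have hB : ((2 * t)⁻¹ • A).PosDef := hA.smul (inv_pos.2 h2t)
  have hBS : (2 * t)⁻¹ • A + S = (2 * t)⁻¹ • (A + (2 * t) • S) := by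
    rw [smul_add, smul_smul, inv_mul_cancel₀ h2t.ne', one_smul]
  have hg := gauss_int _ S hB hS a m
  rw [hBS, inv_smul_mat _ (inv_pos.2 h2t).ne' _ hA, inv_smul_mat _ (inv_pos.2 h2t).ne' _ hAS,
    det_smul, det_smul, inv_inv, mul_div_mul_left _ _ (by positivity)] at hg
  simp only [smul_mulVec, dotProduct_smul, smul_eq_mul, ← mul_assoc] at hg
  rw [show -(1 / 2 : ℝ) * 2 * t = -t by ring] at hg
  have hc : 0 < (2 * Real.pi) ^ d * S.det := mul_pos (by positivity) hS.det_pos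
  unfold gaussianMeasure
  rw [integral_withDensity_eq_integral_toReal_smul]
  · have : ∀ x : Fin d → ℝ, (ENNReal.ofReal (((2 * Real.pi) ^ d * S.det) ^ (-(1 : ℝ) / 2) *
      Real.exp (-(1 / 2) * ((x - m) ⬝ᵥ (S⁻¹ *ᵥ (x - m)))))).toReal •
        Real.exp (-t * ((x - a) ⬝ᵥ (A⁻¹ *ᵥ (x - a)))) =
        ((2 * Real.pi) ^ d * S.det) ^ (-(1 : ℝ) / 2) *
        (Real.exp (-t * ((x - a) ⬝ᵥ (A⁻¹ *ᵥ (x - a)))) *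
          Real.exp (-(1 / 2) * ((x - m) ⬝ᵥ (S⁻¹ *ᵥ (x - m))))) := by
      intro x
      rw [ENNReal.toReal_ofReal (by positivity), smul_eq_mul]
      ring
    simp_rw [this]
    rw [integral_const_mul, hg, ← mul_assoc]
    congr 1
    rw [Real.sqrt_mul hc.le, Real.sqrt_div hA.det_pos.le, neg_div, Real.rpow_neg hc.le,
      Real.rpow_neg hAS.det_pos.le, ← Real.sqrt_eq_rpow, ← Real.sqrt_eq_rpow]
    have := Real.sqrt_pos.2 hc
    field_simp
  · apply Measurable.ennreal_ofReal
    apply Continuous.measurable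
    have : Continuous fun x : Fin d → ℝ => S⁻¹ *ᵥ (x - m) :=
      Continuous.matrix_mulVec continuous_const (by fun_prop)
    have h2 : Continuous fun x : Fin d → ℝ => (x - m) ⬝ᵥ (S⁻¹ *ᵥ (x - m)) :=
      Continuous.dotProduct (by fun_prop) this
    fun_prop
  · exact Filter.Eventually.of_forall fun x => ENNReal.ofReal_lt_top

theorem quad_swap {d : ℕ} (N : Matrix (Fin d) (Fin d) ℝ) (x y : Fin d → ℝ) :
    (x - y) ⬝ᵥ (N *ᵥ (x - y)) = (y - x) ⬝ᵥ (N *ᵥ (y - x)) := by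
  rw [← neg_sub y x, mulVec_neg, neg_dotProduct_neg]

theorem gk_eq {d : ℕ} (σ : ℝ) (x y : Fin d → ℝ) : gaussKernel σ x y =
    Real.exp (-σ * ((y - x) ⬝ᵥ ((1 : Matrix (Fin d) (Fin d) ℝ)⁻¹ *ᵥ (y - x)))) := by
  rw [quad_swap]
  simp [gaussKernel, dotProduct, sq]

theorem gk_sq {d : ℕ} (σ : ℝ) (x y : Fin d → ℝ) :
    gaussKernel σ x y ^ 2 = gaussKernel (2 * σ) x y := by
  rw [gaussKernel, gaussKernel, ← Real.exp_nat_mul]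
  congr 1; push_cast; ring

theorem gk_symm {d : ℕ} (σ : ℝ) (x y : Fin d → ℝ) : gaussKernel σ x y = gaussKernel σ y x := by
  rw [gk_eq, gk_eq, quad_swap]

theorem emb {d : ℕ} (σ : ℝ) (hσ : 0 < σ) (m : Fin d → ℝ) (S : Matrix (Fin d) (Fin d) ℝ)
    (hS : S.PosDef) (x : Fin d → ℝ) :
    ∫ y, gaussKernel σ x y ∂(gaussianMeasure m S) =
      (1 + (2 * σ) • S).det ^ (-(1 : ℝ) / 2) *
        Real.exp (-σ * ((x - m) ⬝ᵥ ((1 + (2 * σ) • S)⁻¹ *ᵥ (x - m)))) := by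
  simp_rw [gk_eq]
  rw [gm_int σ hσ 1 S PosDef.one hS]
  simp

theorem pd {d : ℕ} (c : ℝ) (hc : 0 < c) (S : Matrix (Fin d) (Fin d) ℝ)
    (hS : S.PosDef) : (1 + c • S).PosDef := PosDef.one.add (hS.smul hc)

theorem rp_sqrt (a : ℝ) (ha : 0 < a) : a ^ (-(1 : ℝ) / 2) * Real.sqrt a = 1 := by
  rw [neg_div, Real.rpow_neg ha.le, ← Real.sqrt_eq_rpow]
  exact inv_mul_cancel₀ (Real.sqrt_pos.2 ha).ne'

theorem dbl {d : ℕ} (σ : ℝ) (hσ : 0 < σ) (m n : Fin d → ℝ) (S T : Matrix (Fin d) (Fin d) ℝ)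
    (hS : S.PosDef) (hT : T.PosDef) :
    ∫ x, ∫ y, gaussKernel σ x y ∂(gaussianMeasure n T) ∂(gaussianMeasure m S) =
      (1 + (2 * σ) • S + (2 * σ) • T).det ^ (-(1 : ℝ) / 2) *
        Real.exp (-σ * ((n - m) ⬝ᵥ ((1 + (2 * σ) • S + (2 * σ) • T)⁻¹ *ᵥ (n - m)))) := by
  have h := pd (2 * σ) (by positivity) T hT
  simp_rw [emb σ hσ n T hT]
  rw [integral_const_mul, gm_int σ hσ _ S h hS, ← mul_assoc, ← mul_assoc, rp_sqrt _ h.det_pos,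
    one_mul, add_right_comm]

theorem sqterm {d : ℕ} (σ : ℝ) (hσ : 0 < σ) (m n : Fin d → ℝ) (S T : Matrix (Fin d) (Fin d) ℝ)
    (hS : S.PosDef) (hT : T.PosDef) :
    ∫ x, (∫ y, gaussKernel σ x y ∂(gaussianMeasure n T)) ^ 2 ∂(gaussianMeasure m S) =
      (1 + (2 * σ) • T).det ^ (-(1 : ℝ) / 2) *
      (1 + (2 * σ) • T + (4 * σ) • S).det ^ (-(1 : ℝ) / 2) *
        Real.exp (-(2 * σ) * ((n - m) ⬝ᵥ ((1 + (2 * σ) • T + (4 * σ) • S)⁻¹ *ᵥ (n - m)))) := by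
  have h := pd (2 * σ) (by positivity) T hT
  simp_rw [emb σ hσ n T hT, mul_pow, ← Real.exp_nat_mul, ← mul_assoc]
  rw [show ((2 : ℕ) : ℝ) * -σ = -(2 * σ) by push_cast; ring]
  rw [integral_const_mul, gm_int (2 * σ) (by positivity) _ S h hS, ← mul_assoc, ← mul_assoc, sq,
    mul_assoc (_ ^ _) (_ ^ _) (Real.sqrt _), rp_sqrt _ h.det_pos, mul_one,
    show 2 * (2 * σ) = 4 * σ by ring]

theorem stmt10 (d : ℕ) (hd : 1 ≤ d) (σ : ℝ) (hσ : 0 < σ) (μ m₀ : Fin d → ℝ)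
    (S S₀ : Matrix (Fin d) (Fin d) ℝ) (hSsym : S.IsSymm) (hSpd : S.PosDef)
    (hS₀sym : S₀.IsSymm) (hS₀pd : S₀.PosDef) :
    Jk (gaussKernel σ) (gaussianMeasure μ S) (gaussianMeasure m₀ S₀) =
      ((1 : Matrix (Fin d) (Fin d) ℝ) + (4 * σ) • S + (4 * σ) • S₀).det ^ (-(1 : ℝ) / 2)
        * Real.exp (-(2 * σ) * ((m₀ - μ) ⬝ᵥ
            (((1 : Matrix (Fin d) (Fin d) ℝ) + (4 * σ) • S + (4 * σ) • S₀)⁻¹ *ᵥ (m₀ - μ))))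
      - ((1 : Matrix (Fin d) (Fin d) ℝ) + (2 * σ) • S₀).det ^ (-(1 : ℝ) / 2)
        * ((1 : Matrix (Fin d) (Fin d) ℝ) + (2 * σ) • S₀ + (4 * σ) • S).det ^ (-(1 : ℝ) / 2)
        * Real.exp (-(2 * σ) * ((m₀ - μ) ⬝ᵥ
            (((1 : Matrix (Fin d) (Fin d) ℝ) + (2 * σ) • S₀ + (4 * σ) • S)⁻¹ *ᵥ (m₀ - μ))))
      - ((1 : Matrix (Fin d) (Fin d) ℝ) + (2 * σ) • S).det ^ (-(1 : ℝ) / 2)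
        * ((1 : Matrix (Fin d) (Fin d) ℝ) + (2 * σ) • S + (4 * σ) • S₀).det ^ (-(1 : ℝ) / 2)
        * Real.exp (-(2 * σ) * ((m₀ - μ) ⬝ᵥ
            (((1 : Matrix (Fin d) (Fin d) ℝ) + (2 * σ) • S + (4 * σ) • S₀)⁻¹ *ᵥ (m₀ - μ))))
      + (((1 : Matrix (Fin d) (Fin d) ℝ) + (2 * σ) • S + (2 * σ) • S₀).det)⁻¹
        * Real.exp (-(2 * σ) * ((m₀ - μ) ⬝ᵥ
            (((1 : Matrix (Fin d) (Fin d) ℝ) + (2 * σ) • S + (2 * σ) • S₀)⁻¹ *ᵥ (m₀ - μ)))) := by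
  unfold Jk
  have h2σ : 0 < 2 * σ := by positivity
  have t1 := dbl (2 * σ) h2σ μ m₀ S S₀ hSpd hS₀pd
  have t2 := sqterm σ hσ μ m₀ S S₀ hSpd hS₀pd
  have t3 := sqterm σ hσ m₀ μ S₀ S hS₀pd hSpd
  have t4 := dbl σ hσ μ m₀ S S₀ hSpd hS₀pd
  have hp : (1 + (2 * σ) • S + (2 * σ) • S₀).PosDef := (pd _ h2σ S hSpd).add (hS₀pd.smul h2σ)
  simp_rw [gk_sq]
  rw [t1, t2, t4]
  have e : ∫ y, (∫ x, gaussKernel σ x y ∂(gaussianMeasure μ S)) ^ 2 ∂(gaussianMeasure m₀ S₀) =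
      ∫ y, (∫ x, gaussKernel σ y x ∂(gaussianMeasure μ S)) ^ 2 ∂(gaussianMeasure m₀ S₀) := by
    refine integral_congr_ae (Filter.Eventually.of_forall fun y => ?_)
    have : (fun x => gaussKernel σ x y) = fun x => gaussKernel σ y x :=
      funext fun x => gk_symm σ x y
    simp only [this]
  rw [e, t3, quad_swap _ μ m₀, show 2 * (2 * σ) = 4 * σ by ring, mul_pow, ← Real.exp_nat_mul,
    ← Real.rpow_mul_natCast hp.det_pos.le, ← mul_assoc]
  rw [show -(1 : ℝ) / 2 * ((2 : ℕ) : ℝ) = -1 by norm_num, Real.rpow_neg_one,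
    show ((2 : ℕ) : ℝ) * -σ = -(2 * σ) by push_cast; ring]
end

section
/- Let d ≥ 1, σ > 0, μ, m₀ ∈ ℝ^d, and let Σ, Σ₀ be d×d symmetric positive-definite matrices. Then ∫ ( ∫ exp(−σ‖x−y‖²) dN(m₀,Σ₀)(y) )² dN(μ,Σ)(x) = det(I_d+2σΣ₀)^{-1/2}·det(I_d+2σΣ₀+4σΣ)^{-1/2}·exp(−2σ·(m₀−μ)ᵀ(I_d+2σΣ₀+4σΣ)⁻¹(m₀−μ)). That is, for independent X ∼ N(μ,Σ) and Y ∼ N(m₀,Σ₀), E_X[ (E_Y[k_σ(X,Y)])² ] equals this expression for the Gaussian kernel k_σ. -/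
open MeasureTheory Matrix

lemma gint_std (d : ℕ) : ∫ x : Fin d → ℝ, Real.exp (-(1/2) * (x ⬝ᵥ x)) =
    ((2 * Real.pi) ^ d) ^ ((1:ℝ)/2) := by
  have h : ∀ x : Fin d → ℝ, Real.exp (-(1/2) * (x ⬝ᵥ x)) =
      ∏ i, (fun t : ℝ => Real.exp (-(1/2) * t ^ 2)) (x i) := by
    intro x
    simp only [dotProduct, Finset.mul_sum, ← Real.exp_sum, pow_two]
  simp_rw [h]
  rw [integral_fintype_prod_volume_eq_pow (fun t : ℝ => Real.exp (-(1/2) * t ^ 2)), integral_gaussian, Fintype.card_fin,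
    ← Real.sqrt_eq_rpow, div_div_eq_mul_div, div_one, mul_comm Real.pi,
    Real.sqrt_eq_rpow, Real.sqrt_eq_rpow, ← Real.rpow_natCast, ← Real.rpow_natCast,
    ← Real.rpow_mul (by positivity), ← Real.rpow_mul (by positivity), mul_comm (d : ℝ)]

open scoped MatrixOrder in
lemma gint (d : ℕ) (A : Matrix (Fin d) (Fin d) ℝ) (hA : A.PosDef) :
    ∫ x : Fin d → ℝ, Real.exp (-(1/2) * (x ⬝ᵥ (A *ᵥ x))) =
    ((2 * Real.pi) ^ d) ^ ((1:ℝ)/2) * A.det ^ (-(1:ℝ)/2) := by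
  obtain ⟨B, hB⟩ := CStarAlgebra.nonneg_iff_eq_star_mul_self.mp hA.posSemidef.nonneg
  rw [star_eq_conjTranspose, conjTranspose_eq_transpose_of_trivial] at hB
  have hdet : A.det = B.det ^ 2 := by rw [hB, det_mul, det_transpose, pow_two]
  have hpos := hA.det_pos
  have hB0 : B.det ≠ 0 := by
    intro h; rw [hdet, h] at hpos; norm_num at hpos
  have hq : ∀ x : Fin d → ℝ, Real.exp (-(1/2) * (x ⬝ᵥ (A *ᵥ x))) =
      (fun z => Real.exp (-(1/2) * (z ⬝ᵥ z))) (toLin' B x) := by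
    intro x
    simp only [toLin'_apply, hB]
    rw [← mulVec_mulVec, dotProduct_mulVec, vecMul_transpose]
  simp_rw [hq]
  rw [← integral_map (μ := volume) (φ := toLin' B) (f := fun z => Real.exp (-(1/2) * (z ⬝ᵥ z)))
    (LinearMap.continuous_of_finiteDimensional _).aemeasurable
    (by apply Continuous.aestronglyMeasurable; unfold dotProduct; fun_prop),
    Real.map_matrix_volume_pi_eq_smul_volume_pi hB0, integral_smul_measure, gint_std,
    ENNReal.toReal_ofReal (abs_nonneg _), smul_eq_mul, mul_comm, hdet]
  congr 1
  rw [← sq_abs, ← Real.rpow_natCast, ← Real.rpow_mul (abs_nonneg _), abs_inv]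
  norm_num [Real.rpow_neg_one]

lemma symm_dot {d : ℕ} {A : Matrix (Fin d) (Fin d) ℝ} (h : A.IsSymm) (x y : Fin d → ℝ) :
    x ⬝ᵥ (A *ᵥ y) = y ⬝ᵥ (A *ᵥ x) := by
  rw [dotProduct_mulVec, ← mulVec_transpose, h.eq, dotProduct_comm]

lemma pd_symm {d : ℕ} {A : Matrix (Fin d) (Fin d) ℝ} (h : A.PosDef) : A.IsSymm := by
  have := h.isHermitian.eq
  rwa [conjTranspose_eq_transpose_of_trivial] at this

lemma inv_mv {d : ℕ} {A : Matrix (Fin d) (Fin d) ℝ} (h : A.PosDef) (x : Fin d → ℝ) :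
    A⁻¹ *ᵥ (A *ᵥ x) = x := by
  rw [mulVec_mulVec, nonsing_inv_mul _ h.det_pos.ne'.isUnit, one_mulVec]

lemma mv_inv {d : ℕ} {A : Matrix (Fin d) (Fin d) ℝ} (h : A.PosDef) (x : Fin d → ℝ) :
    A *ᵥ (A⁻¹ *ᵥ x) = x := by
  rw [mulVec_mulVec, mul_nonsing_inv _ h.det_pos.ne'.isUnit, one_mulVec]

lemma square {d : ℕ} {S T : Matrix (Fin d) (Fin d) ℝ} (hS : S.PosDef) (hT : T.PosDef)
    (z r : Fin d → ℝ) :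
    (T *ᵥ z - r) ⬝ᵥ (T⁻¹ *ᵥ (T *ᵥ z - r)) + (S *ᵥ z + r) ⬝ᵥ (S⁻¹ *ᵥ (S *ᵥ z + r)) =
    z ⬝ᵥ ((S + T) *ᵥ z) + r ⬝ᵥ ((S⁻¹ + T⁻¹) *ᵥ r) := by
  have h1 := symm_dot (pd_symm hT.inv) (T *ᵥ z) r
  have h2 := symm_dot (pd_symm hS.inv) (S *ᵥ z) r
  rw [inv_mv hT] at h1
  rw [inv_mv hS] at h2
  simp only [mulVec_sub, mulVec_add, add_mulVec, sub_dotProduct, add_dotProduct, dotProduct_sub,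
    dotProduct_add, inv_mv hT, inv_mv hS, h1, h2, dotProduct_comm (T *ᵥ z) z,
    dotProduct_comm (S *ᵥ z) z]
  ring

lemma gauss_integral {d : ℕ} (m : Fin d → ℝ) (S : Matrix (Fin d) (Fin d) ℝ) (hS : S.PosDef)
    (f : (Fin d → ℝ) → ℝ) :
    ∫ y, f y ∂(gaussianMeasure m S) = ((2 * Real.pi) ^ d * S.det) ^ (-(1 : ℝ) / 2) *
      ∫ y, Real.exp (-(1 / 2) * ((y - m) ⬝ᵥ (S⁻¹ *ᵥ (y - m)))) * f y := by
  have hp := hS.det_pos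
  unfold gaussianMeasure
  rw [integral_withDensity_eq_integral_toReal_smul, ← integral_const_mul]
  · refine integral_congr_ae (.of_forall fun y => ?_)
    simp only [smul_eq_mul]
    rw [ENNReal.toReal_ofReal (by positivity), mul_assoc]
  · apply Measurable.ennreal_ofReal
    apply Continuous.measurable
    unfold dotProduct mulVec dotProduct
    fun_prop
  · simp

lemma conv {d : ℕ} {S T : Matrix (Fin d) (Fin d) ℝ} (hS : S.PosDef) (hT : T.PosDef)
    (m x : Fin d → ℝ) :
    ∫ y, Real.exp (-(1/2) * ((x - y) ⬝ᵥ (T⁻¹ *ᵥ (x - y)))) ∂(gaussianMeasure m S) =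
    T.det ^ ((1:ℝ)/2) * (S + T).det ^ (-(1:ℝ)/2) *
      Real.exp (-(1/2) * ((x - m) ⬝ᵥ ((S + T)⁻¹ *ᵥ (x - m)))) := by
  have hST := hS.add hT
  rw [gauss_integral m S hS]
  obtain ⟨z, hz⟩ : ∃ z, (S + T) *ᵥ z = x - m := ⟨_, mv_inv hST _⟩
  rw [← hz, inv_mv hST, dotProduct_comm _ z]
  have hx : x = S *ᵥ z + T *ᵥ z + m := by rw [← add_mulVec, hz, sub_add_cancel]
  rw [← integral_add_right_eq_self _ (S *ᵥ z + m)]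
  have e : ∀ r : Fin d → ℝ,
      Real.exp (-(1 / 2) * ((r + (S *ᵥ z + m) - m) ⬝ᵥ (S⁻¹ *ᵥ (r + (S *ᵥ z + m) - m)))) *
      Real.exp (-(1/2) * ((x - (r + (S *ᵥ z + m))) ⬝ᵥ (T⁻¹ *ᵥ (x - (r + (S *ᵥ z + m)))))) =
      Real.exp (-(1/2) * (z ⬝ᵥ ((S + T) *ᵥ z))) *
      Real.exp (-(1/2) * (r ⬝ᵥ ((S⁻¹ + T⁻¹) *ᵥ r))) := by
    intro r
    have a1 : r + (S *ᵥ z + m) - m = S *ᵥ z + r := by abel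
    have a2 : x - (r + (S *ᵥ z + m)) = T *ᵥ z - r := by rw [hx]; abel
    rw [a1, a2, ← Real.exp_add, ← Real.exp_add, ← mul_add, ← mul_add, ← square hS hT, add_comm]
  simp_rw [e]
  rw [integral_const_mul, gint d _ (hS.inv.add hT.inv)]
  have hdet : (S⁻¹ + T⁻¹).det = S.det⁻¹ * (S + T).det * T.det⁻¹ := by
    have : S⁻¹ + T⁻¹ = S⁻¹ * (S + T) * T⁻¹ := by
      rw [mul_add, add_mul, nonsing_inv_mul _ hS.det_pos.ne'.isUnit, mul_assoc,
        mul_nonsing_inv _ hT.det_pos.ne'.isUnit, one_mul, mul_one, add_comm]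
    rw [this, det_mul, det_mul, det_nonsing_inv, det_nonsing_inv]
    simp
  have p1 := hS.det_pos
  have p2 := hT.det_pos
  have p3 := hST.det_pos
  have p4 : 0 < (2 * Real.pi) ^ d := by positivity
  rw [hdet]
  generalize S.det = a at *
  generalize T.det = b at *
  generalize (S+T).det = c at *
  generalize (2 * Real.pi) ^ d = p at *
  rw [Real.mul_rpow p4.le p1.le, Real.mul_rpow (by positivity) (by positivity),
    Real.mul_rpow (by positivity) (by positivity), Real.inv_rpow p1.le, Real.inv_rpow p2.le,
    neg_div, Real.rpow_neg p4.le, Real.rpow_neg p1.le, Real.rpow_neg p2.le]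
  have := (Real.rpow_pos_of_pos p4 (1/2)).ne'
  have := (Real.rpow_pos_of_pos p1 (1/2)).ne'
  field_simp


theorem stmt12 (d : ℕ) (hd : 1 ≤ d) (σ : ℝ) (hσ : 0 < σ) (μ m₀ : Fin d → ℝ)
    (S S₀ : Matrix (Fin d) (Fin d) ℝ) (hSsym : S.IsSymm) (hSpd : S.PosDef)
    (hS₀sym : S₀.IsSymm) (hS₀pd : S₀.PosDef) :
    ∫ x, (∫ y, Real.exp (-σ * ∑ i, (x i - y i) ^ 2) ∂(gaussianMeasure m₀ S₀)) ^ 2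
        ∂(gaussianMeasure μ S) =
      ((1 : Matrix (Fin d) (Fin d) ℝ) + (2 * σ) • S₀).det ^ (-(1 : ℝ) / 2)
        * ((1 : Matrix (Fin d) (Fin d) ℝ) + (2 * σ) • S₀ + (4 * σ) • S).det ^ (-(1 : ℝ) / 2)
        * Real.exp (-(2 * σ) * ((m₀ - μ) ⬝ᵥ
            (((1 : Matrix (Fin d) (Fin d) ℝ) + (2 * σ) • S₀ + (4 * σ) • S)⁻¹ *ᵥ (m₀ - μ)))) := by

  set T : Matrix (Fin d) (Fin d) ℝ := (2 * σ)⁻¹ • 1 with hT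
  have hTpd : T.PosDef := Matrix.PosDef.one.smul (by positivity)
  have hTinv : T⁻¹ = (2 * σ) • 1 := by
    apply inv_eq_left_inv
    rw [hT, smul_mul_smul_comm, mul_inv_cancel₀ (by positivity)]; simp
  have hk : ∀ x y : Fin d → ℝ, -σ * ∑ i, (x i - y i) ^ 2 =
      -(1/2) * ((x - y) ⬝ᵥ (T⁻¹ *ᵥ (x - y))) := by
    intro x y
    rw [hTinv, smul_mulVec, one_mulVec, dotProduct_smul, smul_eq_mul]
    simp only [dotProduct, Pi.sub_apply, pow_two]
    ring
  simp_rw [hk, conv hS₀pd hTpd]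
  set U : Matrix (Fin d) (Fin d) ℝ := (1/2 : ℝ) • (S₀ + T) with hU
  have hUpd : U.PosDef := (hS₀pd.add hTpd).smul (by positivity)
  have hUinv : U⁻¹ = (2:ℝ) • (S₀ + T)⁻¹ := by
    apply inv_eq_left_inv
    rw [hU, smul_mul_smul_comm, nonsing_inv_mul _ (hS₀pd.add hTpd).det_pos.ne'.isUnit]; norm_num
  set C := T.det ^ ((1:ℝ)/2) * (S₀ + T).det ^ (-(1:ℝ)/2) with hC
  have hk2 : ∀ x : Fin d → ℝ,
      (C * Real.exp (-(1/2) * ((x - m₀) ⬝ᵥ ((S₀ + T)⁻¹ *ᵥ (x - m₀))))) ^ 2 =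
      C ^ 2 * Real.exp (-(1/2) * ((m₀ - x) ⬝ᵥ (U⁻¹ *ᵥ (m₀ - x)))) := by
    intro x
    rw [mul_pow, ← Real.exp_nat_mul, hUinv, smul_mulVec, dotProduct_smul, smul_eq_mul,
      ← neg_sub m₀ x, mulVec_neg, neg_dotProduct_neg]
    congr 2
    push_cast
    ring
  simp_rw [hk2]
  rw [integral_const_mul, conv hSpd hUpd]
  have e1 : (1 : Matrix (Fin d) (Fin d) ℝ) + (2 * σ) • S₀ = (2 * σ) • (S₀ + T) := by
    rw [hT, smul_add, smul_smul, mul_inv_cancel₀ (by positivity), one_smul, add_comm]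
  have e2 : (1 : Matrix (Fin d) (Fin d) ℝ) + (2 * σ) • S₀ + (4 * σ) • S = (4 * σ) • (S + U) := by
    rw [e1, hU, smul_add (4 * σ) S, smul_smul, add_comm]; congr 2; ring
  have hSU := hSpd.add hUpd
  have e3 : ((4 * σ) • (S + U))⁻¹ = (4 * σ)⁻¹ • (S + U)⁻¹ := by
    apply inv_eq_left_inv
    rw [smul_mul_smul_comm, nonsing_inv_mul _ hSU.det_pos.ne'.isUnit, inv_mul_cancel₀ (by positivity),
      one_smul]
  rw [e2, e3, e1, smul_mulVec, dotProduct_smul, smul_eq_mul]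
  have hD := (hS₀pd.add hTpd).det_pos
  have hW := hSU.det_pos
  have hTd : T.det = ((2 * σ) ^ d)⁻¹ := by
    rw [hT, det_smul, det_one, Fintype.card_fin, mul_one, inv_pow]
  have hUd : U.det = (2 ^ d : ℝ)⁻¹ * (S₀ + T).det := by
    rw [hU, det_smul, Fintype.card_fin, one_div, inv_pow]
  have h4 : (4 * σ) ^ d = (2 ^ d : ℝ) * (2 * σ) ^ d := by rw [← mul_pow]; congr 1; ring
  have hexp : -(1/2) * ((m₀ - μ) ⬝ᵥ ((S + U)⁻¹ *ᵥ (m₀ - μ))) =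
      -(2 * σ) * ((4 * σ)⁻¹ * ((m₀ - μ) ⬝ᵥ ((S + U)⁻¹ *ᵥ (m₀ - μ)))) := by
    generalize (m₀ - μ) ⬝ᵥ ((S + U)⁻¹ *ᵥ (m₀ - μ)) = v
    field_simp
    ring
  rw [hexp, ← mul_assoc]
  congr 1
  have hp : 0 < (2 * σ) ^ d := by positivity
  have hq : (0:ℝ) < 2 ^ d := by positivity
  rw [hC]
  clear_value T U C
  rw [det_smul, det_smul, Fintype.card_fin, hTd, hUd, h4]
  generalize (S₀ + T).det = D at *
  generalize (S + U).det = W at *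
  generalize (2 * σ) ^ d = p at *
  generalize (2:ℝ) ^ d = q at *
  simp only [neg_div, ← Real.sqrt_eq_rpow, Real.rpow_neg hD.le, Real.rpow_neg hW.le,
    Real.rpow_neg (mul_pos hp hD).le, Real.rpow_neg (mul_pos (mul_pos hq hp) hW).le]
  rw [Real.sqrt_mul hp.le, Real.sqrt_mul (mul_pos hq hp).le, Real.sqrt_mul hq.le,
    Real.sqrt_mul (inv_pos.2 hq).le, Real.sqrt_inv, Real.sqrt_inv]
  have := (Real.sqrt_pos.2 hp).ne'
  have := (Real.sqrt_pos.2 hq).ne'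
  have := (Real.sqrt_pos.2 hD).ne'
  have := (Real.sqrt_pos.2 hW).ne'
  field_simp
end

section
/- Let d ≥ 1, σ > 0, μ, m₀ ∈ ℝ^d, and let Σ, Σ₀ be d×d symmetric positive-definite matrices. If X and Y are independent with X ∼ N(μ,Σ) and Y ∼ N(m₀,Σ₀), then E[exp(−σ‖X−Y‖²)] = det(I_d+2σΣ+2σΣ₀)^{-1/2}·exp(−σ·(μ−m₀)ᵀ(I_d+2σΣ+2σΣ₀)⁻¹(μ−m₀)), i.e. ∫∫exp(−σ‖x−y‖²)dN(μ,Σ)(x)dN(m₀,Σ₀)(y) equals this expression. -/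
open MeasureTheory Matrix

noncomputable def gdens {d : ℕ} (S : Matrix (Fin d) (Fin d) ℝ) (v : Fin d → ℝ) : ℝ :=
  ((2 * Real.pi) ^ d * S.det) ^ (-(1 : ℝ) / 2) * Real.exp (-(1 / 2) * (v ⬝ᵥ (S⁻¹ *ᵥ v)))

lemma gdens_neg {d : ℕ} (S : Matrix (Fin d) (Fin d) ℝ) (v : Fin d → ℝ) :
    gdens S (-v) = gdens S v := by
  simp [gdens, mulVec_neg]

lemma gdens_nonneg {d : ℕ} {S : Matrix (Fin d) (Fin d) ℝ} (hS : S.PosDef) (v : Fin d → ℝ) :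
    0 ≤ gdens S v := by
  have := hS.det_pos
  unfold gdens
  positivity

lemma gdens_cont {d : ℕ} (S : Matrix (Fin d) (Fin d) ℝ) : Continuous (gdens S) := by
  unfold gdens
  fun_prop

lemma integral_gm {d : ℕ} {S : Matrix (Fin d) (Fin d) ℝ} (hS : S.PosDef) (m : Fin d → ℝ)
    (f : (Fin d → ℝ) → ℝ) :
    ∫ x, f x ∂(gaussianMeasure m S) = ∫ x, gdens S (x - m) * f x := by
  unfold gaussianMeasure
  rw [integral_withDensity_eq_integral_toReal_smul]
  · congr 1
    ext x
    exact congrArg (· * f x) (ENNReal.toReal_ofReal (gdens_nonneg hS (x - m)))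
  · have : Continuous fun x => gdens S (x - m) := (gdens_cont S).comp (by fun_prop)
    exact this.measurable.ennreal_ofReal
  · simp

lemma int_std (d : ℕ) :
    ∫ x : Fin d → ℝ, Real.exp (-(1 / 2) * (x ⬝ᵥ x)) = ((2 * Real.pi) ^ d) ^ ((1 : ℝ) / 2) := by
  have h : ∀ x : Fin d → ℝ, Real.exp (-(1 / 2) * (x ⬝ᵥ x))
      = ∏ i, Real.exp (-(1 / 2) * (x i) ^ 2) := by
    intro x
    rw [← Real.exp_sum, dotProduct, Finset.mul_sum]
    simp [sq]
  simp_rw [h]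
  rw [integral_fintype_prod_volume_eq_pow (fun t : ℝ => Real.exp (-(1 / 2) * t ^ 2)),
    integral_gaussian, ← Real.sqrt_eq_rpow, Fintype.card_fin]
  rw [eq_comm, Real.sqrt_eq_iff_mul_self_eq (by positivity) (by positivity), ← mul_pow,
    Real.mul_self_sqrt (by positivity)]
  congr 1
  ring

open scoped MatrixOrder Matrix.Norms.L2Operator in
lemma exists_fac {d : ℕ} {P : Matrix (Fin d) (Fin d) ℝ} (hP : P.PosDef) :
    ∃ B : Matrix (Fin d) (Fin d) ℝ, P = Bᵀ * B := by
  obtain ⟨y, hy, h⟩ := CStarAlgebra.isStrictlyPositive_iff_eq_star_mul_self.mp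
    hP.isStrictlyPositive
  exact ⟨y, h⟩

lemma int_quad {d : ℕ} {P : Matrix (Fin d) (Fin d) ℝ} (hP : P.PosDef) :
    ∫ x : Fin d → ℝ, Real.exp (-(1 / 2) * (x ⬝ᵥ (P *ᵥ x))) =
      ((2 * Real.pi) ^ d) ^ ((1 : ℝ) / 2) * P.det ^ (-(1 : ℝ) / 2) := by
  obtain ⟨B, rfl⟩ := exists_fac hP
  have hd := hP.det_pos
  rw [det_mul, det_transpose] at hd
  have hB : B.det ≠ 0 := by
    intro h; simp [h] at hd
  have h : ∀ x : Fin d → ℝ, x ⬝ᵥ ((Bᵀ * B) *ᵥ x) = (toLin' B x) ⬝ᵥ (toLin' B x) := by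
    intro x
    rw [toLin'_apply, ← mulVec_mulVec, dotProduct_mulVec, vecMul_transpose]
  simp_rw [h]
  have := integral_map (μ := volume) (φ := toLin' B)
    (LinearMap.continuous_of_finiteDimensional _).aemeasurable
    (f := fun x => Real.exp (-(1 / 2) * (x ⬝ᵥ x)))
    (Continuous.aestronglyMeasurable (by fun_prop))
  rw [← this, Real.map_matrix_volume_pi_eq_smul_volume_pi hB, integral_smul_measure, int_std,
    ENNReal.toReal_ofReal (abs_nonneg _), det_mul, det_transpose, smul_eq_mul, mul_comm]
  congr 1
  rw [neg_div, Real.rpow_neg hd.le, ← Real.sqrt_eq_rpow, Real.sqrt_mul_self_eq_abs, abs_inv]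

lemma conv_s13 {d : ℕ} {A B : Matrix (Fin d) (Fin d) ℝ} (hA : A.PosDef) (hB : B.PosDef)
    (x b : Fin d → ℝ) :
    ∫ y, gdens A (x - y) * gdens B (y - b) = gdens (A + B) (x - b) := by
  have hAB := hA.add hB
  have uA : IsUnit A.det := hA.det_pos.ne'.isUnit
  have uB : IsUnit B.det := hB.det_pos.ne'.isUnit
  have uAB : IsUnit (A + B).det := hAB.det_pos.ne'.isUnit
  have pA := hA.det_pos
  have pB := hB.det_pos
  have pAB := hAB.det_pos
  have tA : Aᵀ = A := by simpa using hA.isHermitian.eq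
  have tB : Bᵀ = B := by simpa using hB.isHermitian.eq
  obtain ⟨u, hu⟩ : ∃ u, (A + B) *ᵥ u = x - b :=
    ⟨(A + B)⁻¹ *ᵥ (x - b), by rw [mulVec_mulVec, mul_nonsing_inv _ uAB, one_mulVec]⟩
  have hsq : ∀ (M : Matrix (Fin d) (Fin d) ℝ), IsUnit M.det → Mᵀ = M → ∀ z : Fin d → ℝ,
      (M *ᵥ u + z) ⬝ᵥ (M⁻¹ *ᵥ (M *ᵥ u + z)) =
        u ⬝ᵥ (M *ᵥ u) + 2 * (u ⬝ᵥ z) + z ⬝ᵥ (M⁻¹ *ᵥ z) := by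
    intro M hM ht z
    have h1 : (M *ᵥ u) ⬝ᵥ (M⁻¹ *ᵥ z) = u ⬝ᵥ z := by
      rw [dotProduct_mulVec, ← mulVec_transpose, transpose_nonsing_inv, ht, mulVec_mulVec,
        nonsing_inv_mul _ hM, one_mulVec]
    rw [mulVec_add, mulVec_mulVec, nonsing_inv_mul _ hM, one_mulVec, dotProduct_add,
      add_dotProduct, add_dotProduct, h1, dotProduct_comm z u, dotProduct_comm (M *ᵥ u) u]
    ring
  rw [← integral_add_right_eq_self _ (b + B *ᵥ u)]
  have key : ∀ z : Fin d → ℝ,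
      gdens A (x - (z + (b + B *ᵥ u))) * gdens B (z + (b + B *ᵥ u) - b) =
      (((2 * Real.pi) ^ d * A.det) ^ (-(1 : ℝ) / 2) * ((2 * Real.pi) ^ d * B.det) ^ (-(1 : ℝ) / 2)
        * Real.exp (-(1 / 2) * ((x - b) ⬝ᵥ ((A + B)⁻¹ *ᵥ (x - b))))) *
        Real.exp (-(1 / 2) * (z ⬝ᵥ ((A⁻¹ + B⁻¹) *ᵥ z))) := by
    intro z
    have e1 : x - (z + (b + B *ᵥ u)) = A *ᵥ u + (-z) := by
      have : x = (A + B) *ᵥ u + b := by rw [hu]; abel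
      rw [this, add_mulVec]; abel
    have e2 : z + (b + B *ᵥ u) - b = B *ᵥ u + z := by abel
    have e3 := hsq (A + B) uAB (by rw [transpose_add, tA, tB]) 0
    simp only [add_zero, hu, dotProduct_zero, mul_zero, zero_dotProduct] at e3
    rw [e1, e2, e3, ← hu]
    unfold gdens
    rw [hsq A uA tA, hsq B uB tB, mul_mul_mul_comm, ← Real.exp_add, mul_assoc _ (Real.exp _),
      ← Real.exp_add]
    congr 2
    simp only [dotProduct_neg, neg_dotProduct, mulVec_neg, add_mulVec, dotProduct_add]
    ring
  simp_rw [key]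
  rw [integral_const_mul, int_quad (hA.inv.add hB.inv)]
  have hdet : (A⁻¹ + B⁻¹).det = (A + B).det / (A.det * B.det) := by
    have : A⁻¹ + B⁻¹ = A⁻¹ * (A + B) * B⁻¹ := by
      rw [mul_add, nonsing_inv_mul _ uA, add_mul, one_mul, mul_assoc, mul_nonsing_inv _ uB,
        mul_one, add_comm]
    rw [this, det_mul, det_mul, det_nonsing_inv, det_nonsing_inv, Ring.inverse_eq_inv']
    field_simp
  rw [hdet]
  unfold gdens
  have hp : 0 < (2 * Real.pi) ^ d := by positivity
  generalize (2 * Real.pi) ^ d = p at *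
  generalize Real.exp _ = e
  rw [Real.mul_rpow hp.le pA.le, Real.mul_rpow hp.le pB.le, Real.mul_rpow hp.le pAB.le,
    Real.div_rpow pAB.le (by positivity), Real.mul_rpow pA.le pB.le]
  have h1 : p ^ (-(1 : ℝ) / 2) * p ^ ((1 : ℝ) / 2) = 1 := by
    rw [← Real.rpow_add hp]; norm_num
  have h2 : 0 < A.det ^ (-(1 : ℝ) / 2) := by positivity
  have h3 : 0 < B.det ^ (-(1 : ℝ) / 2) := by positivity
  generalize p ^ (-(1 : ℝ) / 2) = p1 at *
  generalize p ^ ((1 : ℝ) / 2) = p2 at *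
  generalize A.det ^ (-(1 : ℝ) / 2) = a at *
  generalize B.det ^ (-(1 : ℝ) / 2) = b at *
  generalize (A + B).det ^ (-(1 : ℝ) / 2) = c at *
  field_simp
  linear_combination (p1 * e * c) * h1

theorem stmt13 (d : ℕ) (hd : 1 ≤ d) (σ : ℝ) (hσ : 0 < σ) (μ m₀ : Fin d → ℝ)
    (S S₀ : Matrix (Fin d) (Fin d) ℝ) (hSsym : S.IsSymm) (hSpd : S.PosDef)
    (hS₀sym : S₀.IsSymm) (hS₀pd : S₀.PosDef) :
    ∫ x, ∫ y, Real.exp (-σ * ∑ i, (x i - y i) ^ 2)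
        ∂(gaussianMeasure m₀ S₀) ∂(gaussianMeasure μ S) =
      ((1 : Matrix (Fin d) (Fin d) ℝ) + (2 * σ) • S + (2 * σ) • S₀).det ^ (-(1 : ℝ) / 2)
        * Real.exp (-σ * ((μ - m₀) ⬝ᵥ
            (((1 : Matrix (Fin d) (Fin d) ℝ) + (2 * σ) • S + (2 * σ) • S₀)⁻¹ *ᵥ (μ - m₀)))) := by
  have h2 : 0 < 2 * σ := by positivity
  obtain ⟨C, hC⟩ : ∃ C : Matrix (Fin d) (Fin d) ℝ, C = (2 * σ)⁻¹ • 1 := ⟨_, rfl⟩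
  have hCpd : C.PosDef := hC ▸ Matrix.PosDef.one.smul (by positivity)
  have hM : (1 : Matrix (Fin d) (Fin d) ℝ) + (2 * σ) • S + (2 * σ) • S₀
      = (2 * σ) • (S + (C + S₀)) := by
    rw [hC, smul_add, smul_add, smul_smul, mul_inv_cancel₀ h2.ne', one_smul]
    abel
  have hT := hSpd.add (hCpd.add hS₀pd)
  have hCi : C⁻¹ = (2 * σ) • 1 := by
    apply inv_eq_left_inv
    rw [hC, smul_mul_smul, mul_inv_cancel₀ h2.ne', one_smul, one_mul]
  have hCd : C.det = ((2 * σ) ^ d)⁻¹ := by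
    rw [hC, det_smul, det_one, mul_one, Fintype.card_fin, inv_pow]
  have pC := hCpd.det_pos
  have pT := hT.det_pos
  have hp : 0 < (2 * Real.pi) ^ d := by positivity
  have hk : ∀ x y : Fin d → ℝ, Real.exp (-σ * ∑ i, (x i - y i) ^ 2) =
      ((2 * Real.pi) ^ d * C.det) ^ ((1 : ℝ) / 2) * gdens C (x - y) := by
    intro x y
    unfold gdens
    rw [← mul_assoc, ← Real.rpow_add (by positivity)]
    rw [show (1 : ℝ) / 2 + -1 / 2 = 0 by norm_num, Real.rpow_zero, one_mul]
    rw [hCi, smul_mulVec, one_mulVec, dotProduct_smul, smul_eq_mul]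
    simp only [dotProduct, Pi.sub_apply, sq]
    congr 1
    ring
  simp_rw [integral_gm hS₀pd, integral_gm hSpd, hk]
  have hin : ∀ x, ∫ y, gdens S₀ (y - m₀) * (((2 * Real.pi) ^ d * C.det) ^ ((1 : ℝ) / 2) *
      gdens C (x - y)) = ((2 * Real.pi) ^ d * C.det) ^ ((1 : ℝ) / 2) * gdens (C + S₀) (x - m₀) := by
    intro x
    rw [← conv_s13 hCpd hS₀pd, ← integral_const_mul]
    congr 1; ext y; ring
  simp_rw [hin]
  have hout : ∫ x, gdens S (x - μ) * (((2 * Real.pi) ^ d * C.det) ^ ((1 : ℝ) / 2) *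
      gdens (C + S₀) (x - m₀)) =
      ((2 * Real.pi) ^ d * C.det) ^ ((1 : ℝ) / 2) * gdens (S + (C + S₀)) (μ - m₀) := by
    rw [← conv_s13 hSpd (hCpd.add hS₀pd), ← integral_const_mul]
    congr 1; ext x
    rw [← gdens_neg S (x - μ), neg_sub]; ring
  rw [hout, hM]
  have hTi : ((2 * σ) • (S + (C + S₀)))⁻¹ = (2 * σ)⁻¹ • (S + (C + S₀))⁻¹ := by
    apply inv_eq_left_inv
    rw [smul_mul_smul, inv_mul_cancel₀ h2.ne', one_smul, nonsing_inv_mul _ pT.ne'.isUnit]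
  rw [hTi, det_smul, Fintype.card_fin, smul_mulVec, dotProduct_smul, smul_eq_mul]
  unfold gdens
  rw [← mul_assoc]
  congr 1
  · rw [hCd, Real.mul_rpow hp.le (by positivity), Real.mul_rpow hp.le pT.le,
      Real.mul_rpow (by positivity) pT.le, Real.inv_rpow (by positivity), neg_div,
      Real.rpow_neg hp.le, Real.rpow_neg (x := (2 * σ) ^ d) (by positivity)]
    have : 0 < ((2 * Real.pi) ^ d) ^ ((1 : ℝ) / 2) := by positivity
    field_simp
  · congr 1
    field_simp
end
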